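/- arXiv:2103.12214 — 5 statements merged into one kernel-verified Lean document; each statement's English description precedes it below -/
import Mathlib

section
/- Let σ > 0, μ₀ ≥ 0, and α, m ∈ ℝ, and set a = μ₀ cos(m − α). Then ∫_{0}^{∞} (r/(2πσ²)) · exp(−((r cos m − μ₀ cos α)² + (r sin m − μ₀ sin α)²)/(2σ²)) dr = φ(μ₀ sin(m − α)/σ) · ( φ(a/σ) + (a/σ)·Φ(a/σ) ). In other words, the projected normal density in two dimensions obtained by marginalizing the radius of a bivariate Gaussian with mean μ₀(cos α, sin α) and covariance σ²·I₂ has this closed form. -/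
open MeasureTheory

/-- standard normal density -/
noncomputable def stdPhi (x : ℝ) : ℝ := (Real.sqrt (2 * Real.pi))⁻¹ * Real.exp (-x ^ 2 / 2)

/-- standard normal CDF -/
noncomputable def stdPhiCDF (x : ℝ) : ℝ := ∫ t in Set.Iic x, stdPhi t

lemma integrable_stdPhi : Integrable stdPhi := by
  have h := (integrable_exp_neg_mul_sq (b := 1 / 2) (by norm_num)).const_mul
    (Real.sqrt (2 * Real.pi))⁻¹
  refine h.congr (Filter.Eventually.of_forall fun x => ?_)
  simp only [stdPhi]
  ring_nf

lemma integrable_mul_stdPhi : Integrable fun x => x * stdPhi x := by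
  have h := (integrable_mul_exp_neg_mul_sq (b := 1 / 2) (by norm_num)).const_mul
    (Real.sqrt (2 * Real.pi))⁻¹
  refine h.congr (Filter.Eventually.of_forall fun x => ?_)
  simp only [stdPhi]
  ring_nf

lemma stdPhi_neg (x : ℝ) : stdPhi (-x) = stdPhi x := by
  simp [stdPhi]

lemma hasDerivAt_stdPhi (x : ℝ) : HasDerivAt stdPhi (-(x * stdPhi x)) x := by
  have h : HasDerivAt (fun y : ℝ => -y ^ 2 / 2) (-x) x :=
    ((hasDerivAt_pow 2 x).fun_neg.div_const 2).congr_deriv (by norm_num; ring)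
  refine (h.exp.const_mul (Real.sqrt (2 * Real.pi))⁻¹).congr_deriv ?_
  rw [stdPhi]
  ring

lemma tendsto_stdPhi_atTop : Filter.Tendsto stdPhi Filter.atTop (nhds 0) := by
  have h : Filter.Tendsto (fun x : ℝ => -x ^ 2 / 2) Filter.atTop Filter.atBot := by
    have := Filter.tendsto_neg_atTop_atBot.comp
      ((Filter.tendsto_pow_atTop (α := ℝ) two_ne_zero).atTop_div_const two_pos)
    refine this.congr fun x => ?_
    simp only [Function.comp_apply]
    ring
  rw [← mul_zero (Real.sqrt (2 * Real.pi))⁻¹]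
  exact (Real.tendsto_exp_atBot.comp h).const_mul _

lemma integral_Ioi_stdPhi_sub (c : ℝ) :
    ∫ s in Set.Ioi (0 : ℝ), stdPhi (s - c) = stdPhiCDF c := by
  have h := (Measure.measurePreserving_sub_left (volume : Measure ℝ) c).setIntegral_preimage_emb
    (MeasurableEquiv.subLeft c).measurableEmbedding stdPhi (Set.Iio c)
  rw [stdPhiCDF, integral_Iic_eq_integral_Iio, ← h]
  have hs : (fun s : ℝ => c - s) ⁻¹' Set.Iio c = Set.Ioi 0 := by
    ext s
    simp
  rw [hs]
  refine integral_congr_ae (Filter.Eventually.of_forall fun s => ?_)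
  simp only
  rw [← stdPhi_neg, neg_sub]

lemma integral_Ioi_sub_mul_stdPhi_sub (c : ℝ) :
    ∫ s in Set.Ioi (0 : ℝ), (s - c) * stdPhi (s - c) = stdPhi c := by
  have hd (s : ℝ) : HasDerivAt (fun s => -stdPhi (s - c)) ((s - c) * stdPhi (s - c)) s := by
    simpa using ((hasDerivAt_stdPhi (s - c)).comp_sub_const s c).fun_neg
  have ht : Filter.Tendsto (fun s => -stdPhi (s - c)) Filter.atTop (nhds 0) := by
    simpa [sub_eq_add_neg] using (tendsto_stdPhi_atTop.comp
      (Filter.tendsto_atTop_add_const_right _ (-c) Filter.tendsto_id)).neg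
  rw [integral_Ioi_of_hasDerivAt_of_tendsto' (fun s _ => hd s)
    (integrable_mul_stdPhi.comp_sub_right c).integrableOn ht]
  simp [stdPhi_neg]

lemma integral_Ioi_mul_stdPhi_sub (c : ℝ) :
    ∫ s in Set.Ioi (0 : ℝ), s * stdPhi (s - c) = stdPhi c + c * stdPhiCDF c := by
  rw [← integral_Ioi_sub_mul_stdPhi_sub, ← integral_Ioi_stdPhi_sub, ← integral_const_mul,
    ← integral_add (integrable_mul_stdPhi.comp_sub_right c).integrableOn
      ((integrable_stdPhi.comp_sub_right c).const_mul c).integrableOn]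
  congr 1 with s
  ring

lemma stdPhi_mul_stdPhi (x y : ℝ) :
    stdPhi x * stdPhi y = (2 * Real.pi)⁻¹ * Real.exp (-(x ^ 2 + y ^ 2) / 2) := by
  have h : (2 * Real.pi)⁻¹ = (Real.sqrt (2 * Real.pi))⁻¹ * (Real.sqrt (2 * Real.pi))⁻¹ := by
    rw [← mul_inv, Real.mul_self_sqrt (by positivity)]
  rw [h, show -(x ^ 2 + y ^ 2) / 2 = -x ^ 2 / 2 + -y ^ 2 / 2 by ring, Real.exp_add, stdPhi, stdPhi]
  ring

lemma sq_dist_polar (r μ α m : ℝ) :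
    (r * Real.cos m - μ * Real.cos α) ^ 2 + (r * Real.sin m - μ * Real.sin α) ^ 2 =
      (μ * Real.sin (m - α)) ^ 2 + (r - μ * Real.cos (m - α)) ^ 2 := by
  rw [Real.cos_sub]
  have h := Real.sin_sq_add_cos_sq (m - α)
  rw [Real.cos_sub] at h
  linear_combination r ^ 2 * Real.sin_sq_add_cos_sq m + μ ^ 2 * Real.sin_sq_add_cos_sq α - μ ^ 2 * h

theorem stmt_1 (σ μ₀ α m : ℝ) (hσ : 0 < σ) (hμ₀ : 0 ≤ μ₀)
    (a : ℝ) (ha : a = μ₀ * Real.cos (m - α)) :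
    (∫ r in Set.Ioi (0 : ℝ),
        (r / (2 * Real.pi * σ ^ 2)) *
          Real.exp (-((r * Real.cos m - μ₀ * Real.cos α) ^ 2 +
              (r * Real.sin m - μ₀ * Real.sin α) ^ 2) / (2 * σ ^ 2)))
      = stdPhi (μ₀ * Real.sin (m - α) / σ) *
          (stdPhi (a / σ) + (a / σ) * stdPhiCDF (a / σ)) := by
  set b := μ₀ * Real.sin (m - α) with hb
  have key (r : ℝ) : (r / (2 * Real.pi * σ ^ 2)) *
      Real.exp (-((r * Real.cos m - μ₀ * Real.cos α) ^ 2 +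
        (r * Real.sin m - μ₀ * Real.sin α) ^ 2) / (2 * σ ^ 2)) =
      stdPhi (b / σ) * σ⁻¹ * ((σ⁻¹ * r) * stdPhi (σ⁻¹ * r - a / σ)) := by
    rw [sq_dist_polar, ← ha, ← hb]
    have hexp : -(b ^ 2 + (r - a) ^ 2) / (2 * σ ^ 2) =
        -((b / σ) ^ 2 + (σ⁻¹ * r - a / σ) ^ 2) / 2 := by
      field_simp
    have h := stdPhi_mul_stdPhi (b / σ) (σ⁻¹ * r - a / σ)
    rw [hexp]
    calc _ = σ⁻¹ * (σ⁻¹ * r) * ((2 * Real.pi)⁻¹ *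
          Real.exp (-((b / σ) ^ 2 + (σ⁻¹ * r - a / σ) ^ 2) / 2)) := by
          field_simp
      _ = _ := by rw [← h]; ring
  simp_rw [key]
  rw [integral_const_mul,
    integral_comp_mul_left_Ioi (fun s => s * stdPhi (s - a / σ)) 0 (inv_pos.mpr hσ),
    mul_zero, integral_Ioi_mul_stdPhi_sub, smul_eq_mul, inv_inv]
  field_simp
end

section
/- Let ρ > 0, m ∈ ℝ, and n ∈ ℕ. Then ∫_{0}^{2π} cos(n(y − m)) · vM(y | m, ρ) dy = I_n(ρ)/I_0(ρ) and ∫_{0}^{2π} sin(n(y − m)) · vM(y | m, ρ) dy = 0. In particular, the circular mean of the von Mises distribution is m with mean resultant length I_1(ρ)/I_0(ρ), and its circular variance equals 1 − I_1(ρ)/I_0(ρ). -/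
open MeasureTheory

/-- modified Bessel function of the first kind of integer order -/
noncomputable def besselI (n : ℕ) (ρ : ℝ) : ℝ :=
  (1 / (2 * Real.pi)) * ∫ y in (0:ℝ)..(2 * Real.pi), Real.cos (n * y) * Real.exp (ρ * Real.cos y)

/-- von Mises density with mean angle m and concentration ρ -/
noncomputable def vM (y m ρ : ℝ) : ℝ :=
  Real.exp (ρ * Real.cos (y - m)) / (2 * Real.pi * besselI 0 ρ)

theorem Function.Periodic.intervalIntegral_comp_sub {f : ℝ → ℝ} {T : ℝ}
    (hf : Function.Periodic f T) (m : ℝ) :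
    ∫ y in (0:ℝ)..T, f (y - m) = ∫ y in (0:ℝ)..T, f y := by
  rw [intervalIntegral.integral_comp_sub_right]
  have h := hf.intervalIntegral_add_eq (0 - m) 0
  rwa [zero_add, show 0 - m + T = T - m by ring] at h

theorem Function.Periodic.intervalIntegral_eq_zero_of_odd {f : ℝ → ℝ} {T : ℝ}
    (hf : Function.Periodic f T) (hodd : ∀ y, f (-y) = -f y) :
    ∫ y in (0:ℝ)..T, f y = 0 := by
  have h : ∫ y in (0:ℝ)..T, f (T - y) = ∫ y in (0:ℝ)..T, f y := by
    rw [intervalIntegral.integral_comp_sub_left]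
    simp
  have h' : ∀ y, f (T - y) = -f y := fun y => by
    rw [← hodd, ← hf (-y)]
    congr 1
    ring
  simp only [h', intervalIntegral.integral_neg] at h
  linarith

theorem periodic_comp_nat_mul_mul_exp_cos {g : ℝ → ℝ}
    (hg : Function.Periodic g (2 * Real.pi)) (n : ℕ) (ρ : ℝ) :
    Function.Periodic (fun y => g (n * y) * Real.exp (ρ * Real.cos y)) (2 * Real.pi) := by
  intro y
  simp only [Real.cos_add_two_pi, mul_add, hg.nat_mul n (n * y)]

theorem integral_comp_nat_mul_sub_mul_vM {g : ℝ → ℝ}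
    (hg : Function.Periodic g (2 * Real.pi)) (n : ℕ) (m ρ : ℝ) :
    ∫ y in (0:ℝ)..(2 * Real.pi), g (n * (y - m)) * vM y m ρ =
      (∫ y in (0:ℝ)..(2 * Real.pi), g (n * y) * Real.exp (ρ * Real.cos y)) /
        (2 * Real.pi * besselI 0 ρ) := by
  simp only [vM, ← mul_div_assoc, intervalIntegral.integral_div]
  rw [(periodic_comp_nat_mul_mul_exp_cos hg n ρ).intervalIntegral_comp_sub m]

theorem stmt_2 (ρ m : ℝ) (hρ : 0 < ρ) (n : ℕ) :
    (∫ y in (0:ℝ)..(2 * Real.pi), Real.cos (n * (y - m)) * vM y m ρ)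
        = besselI n ρ / besselI 0 ρ ∧
    (∫ y in (0:ℝ)..(2 * Real.pi), Real.sin (n * (y - m)) * vM y m ρ) = 0 := by
  constructor
  · rw [integral_comp_nat_mul_sub_mul_vM Real.cos_periodic, ← div_div,
      div_eq_inv_mul _ (2 * Real.pi), ← one_div]
    rfl
  · rw [integral_comp_nat_mul_sub_mul_vM Real.sin_periodic,
      (periodic_comp_nat_mul_mul_exp_cos Real.sin_periodic n ρ).intervalIntegral_eq_zero_of_odd
        (fun y => by simp), zero_div]
end

section
/- Let σ > 0, μ₀ ≥ 0, α ∈ ℝ, and let PN(m) = φ(μ₀ sin(m−α)/σ)·(φ(a(m)/σ) + (a(m)/σ)·Φ(a(m)/σ)) with a(m) = μ₀ cos(m−α) be the projected normal density on [0, 2π). Then ∫_{0}^{2π} cos(m − α) · PN(m) dm = (1/2)·√(2πβ) · e^{−β} · ( I_0(β) + I_1(β) ), where β = μ₀²/(4σ²). Consequently the circular variance of this projected normal distribution is 1 − (1/2)√(2πβ) e^{−β}(I_0(β) + I_1(β)). -/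
open MeasureTheory

/-- projected normal density on [0, 2π) with parameters μ₀ ≥ 0, α, σ > 0 -/
noncomputable def projNormal (μ₀ α σ m : ℝ) : ℝ :=
  stdPhi (μ₀ * Real.sin (m - α) / σ) *
    (stdPhi (μ₀ * Real.cos (m - α) / σ) +
      (μ₀ * Real.cos (m - α) / σ) * stdPhiCDF (μ₀ * Real.cos (m - α) / σ))

lemma continuous_stdPhi : Continuous stdPhi := by
  unfold stdPhi; fun_prop

lemma stdPhi_eq_gaussianPDFReal : stdPhi = ProbabilityTheory.gaussianPDFReal 0 1 := by
  ext x
  simp [stdPhi, ProbabilityTheory.gaussianPDFReal]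

lemma integral_stdPhi : ∫ x, stdPhi x = 1 := by
  rw [stdPhi_eq_gaussianPDFReal]
  exact ProbabilityTheory.integral_gaussianPDFReal_eq_one 0 one_ne_zero

lemma continuous_stdPhiCDF : Continuous stdPhiCDF := by
  have h : stdPhiCDF = fun x => stdPhiCDF 0 + ∫ t in (0:ℝ)..x, stdPhi t := by
    ext x
    have := intervalIntegral.integral_Iic_sub_Iic (a := 0) (b := x)
      integrable_stdPhi.integrableOn integrable_stdPhi.integrableOn
    simp only [stdPhiCDF]
    linarith
  rw [h]
  exact continuous_const.add
    (intervalIntegral.continuous_primitive (fun _ _ => integrable_stdPhi.intervalIntegrable) 0)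

lemma stdPhiCDF_add_neg (x : ℝ) : stdPhiCDF x + stdPhiCDF (-x) = 1 := by
  have h1 : stdPhiCDF (-x) = ∫ t in Set.Ioi x, stdPhi t := by
    have := integral_comp_neg_Iic (-x) stdPhi
    simp only [stdPhi_neg, neg_neg] at this
    exact this
  rw [h1, stdPhiCDF,
    intervalIntegral.integral_Iic_add_Ioi integrable_stdPhi.integrableOn
      integrable_stdPhi.integrableOn,
    integral_stdPhi]

/-- Averaging a `2π`-periodic function over a half-period shift. -/
lemma integral_eq_half_integral_add_shift {G : ℝ → ℝ} (hG : Continuous G)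
    (hper : Function.Periodic G (2 * Real.pi)) :
    ∫ θ in (0:ℝ)..(2 * Real.pi), G θ
      = (1 / 2) * ∫ θ in (0:ℝ)..(2 * Real.pi), (G θ + G (θ + Real.pi)) := by
  have hshift : ∫ θ in (0:ℝ)..(2 * Real.pi), G (θ + Real.pi)
      = ∫ θ in (0:ℝ)..(2 * Real.pi), G θ := by
    have := hper.intervalIntegral_add_eq Real.pi 0
    rw [intervalIntegral.integral_comp_add_right]
    simpa [add_comm] using this
  rw [intervalIntegral.integral_add (hG.intervalIntegrable _ _)
    (Continuous.intervalIntegrable (by fun_prop) _ _), hshift]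
  ring

lemma integral_comp_two_mul_of_periodic {f : ℝ → ℝ} (hf : Continuous f)
    (hper : Function.Periodic f (2 * Real.pi)) :
    ∫ θ in (0:ℝ)..(2 * Real.pi), f (2 * θ) = ∫ θ in (0:ℝ)..(2 * Real.pi), f θ := by
  have h2 := hper.intervalIntegral_add_eq (2 * Real.pi) 0
  have h3 := intervalIntegral.integral_add_adjacent_intervals (μ := volume)
    (hf.intervalIntegrable 0 (2 * Real.pi))
    (hf.intervalIntegrable (2 * Real.pi) (2 * Real.pi + 2 * Real.pi))
  rw [intervalIntegral.integral_comp_mul_left _ two_ne_zero, smul_eq_mul, mul_zero,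
    two_mul (2 * Real.pi), ← h3, h2, zero_add]
  ring

lemma besselI_zero_add_one (ρ : ℝ) :
    besselI 0 ρ + besselI 1 ρ = (1 / (2 * Real.pi)) *
      ∫ y in (0:ℝ)..(2 * Real.pi), (1 + Real.cos y) * Real.exp (ρ * Real.cos y) := by
  simp only [besselI]
  rw [← mul_add, ← intervalIntegral.integral_add
    (Continuous.intervalIntegrable (by fun_prop) _ _)
    (Continuous.intervalIntegrable (by fun_prop) _ _)]
  congr 2
  ext y
  simp
  ring

lemma integral_cos_sq_mul_stdPhi (k : ℝ) :
    ∫ θ in (0:ℝ)..(2 * Real.pi), Real.cos θ ^ 2 * stdPhi (k * Real.sin θ)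
      = (1 / 2) * Real.sqrt (2 * Real.pi) * Real.exp (-(k ^ 2 / 4)) *
        (besselI 0 (k ^ 2 / 4) + besselI 1 (k ^ 2 / 4)) := by
  have hpt : ∀ θ : ℝ, Real.cos θ ^ 2 * stdPhi (k * Real.sin θ)
      = (1 / 2) * (Real.sqrt (2 * Real.pi))⁻¹ * Real.exp (-(k ^ 2 / 4)) *
        ((1 + Real.cos (2 * θ)) * Real.exp (k ^ 2 / 4 * Real.cos (2 * θ))) := by
    intro θ
    have he : -(k * Real.sin θ) ^ 2 / 2
        = -(k ^ 2 / 4) + k ^ 2 / 4 * Real.cos (2 * θ) := by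
      rw [Real.cos_two_mul, mul_pow, Real.sin_sq]
      ring
    rw [stdPhi, he, Real.exp_add, Real.cos_two_mul]
    ring
  simp only [hpt]
  rw [intervalIntegral.integral_const_mul,
    integral_comp_two_mul_of_periodic
      (f := fun y => (1 + Real.cos y) * Real.exp (k ^ 2 / 4 * Real.cos y))
      (by fun_prop) (fun y => by simp only [Real.cos_add_two_pi]),
    besselI_zero_add_one]
  have hs : Real.sqrt (2 * Real.pi) ^ 2 = 2 * Real.pi := Real.sq_sqrt (by positivity)
  have hs0 : Real.sqrt (2 * Real.pi) ≠ 0 := by positivity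
  have hinv : (Real.sqrt (2 * Real.pi))⁻¹ = Real.sqrt (2 * Real.pi) * (1 / (2 * Real.pi)) := by
    field_simp
    exact hs.symm
  rw [hinv]
  ring

theorem stmt_3 (σ μ₀ α : ℝ) (hσ : 0 < σ) (hμ₀ : 0 ≤ μ₀)
    (β : ℝ) (hβ : β = μ₀ ^ 2 / (4 * σ ^ 2)) :
    (∫ m in (0:ℝ)..(2 * Real.pi), Real.cos (m - α) * projNormal μ₀ α σ m)
      = (1 / 2) * Real.sqrt (2 * Real.pi * β) * Real.exp (-β) *
          (besselI 0 β + besselI 1 β) := by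
  set k : ℝ := μ₀ / σ with hk
  have hk0 : 0 ≤ k := by positivity
  have hβk : β = k ^ 2 / 4 := by
    rw [hβ, hk]
    field_simp
  set G : ℝ → ℝ := fun θ => Real.cos θ * (stdPhi (k * Real.sin θ) *
    (stdPhi (k * Real.cos θ) + k * Real.cos θ * stdPhiCDF (k * Real.cos θ))) with hGdef
  have hGc : Continuous G := by
    have h1 := continuous_stdPhi
    have h2 := continuous_stdPhiCDF
    fun_prop
  have hGp : Function.Periodic G (2 * Real.pi) := fun θ => by
    simp only [hGdef, Real.cos_add_two_pi, Real.sin_add_two_pi]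
  have hG : ∀ m, Real.cos (m - α) * projNormal μ₀ α σ m = G (m - α) := by
    intro m
    simp only [hGdef, projNormal, hk, div_mul_eq_mul_div]
  have hshift : ∫ m in (0:ℝ)..(2 * Real.pi), G (m - α) = ∫ θ in (0:ℝ)..(2 * Real.pi), G θ := by
    have := hGp.intervalIntegral_add_eq (-α) 0
    rw [intervalIntegral.integral_comp_sub_right]
    simpa [sub_eq_add_neg, add_comm] using this
  have hsum : ∀ θ, G θ + G (θ + Real.pi)
      = k * (Real.cos θ ^ 2 * stdPhi (k * Real.sin θ)) := by
    intro θ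
    simp only [hGdef, Real.cos_add_pi, Real.sin_add_pi, mul_neg, stdPhi_neg]
    linear_combination (k * Real.cos θ ^ 2 * stdPhi (k * Real.sin θ)) *
      stdPhiCDF_add_neg (k * Real.cos θ)
  have hsqrt : Real.sqrt (2 * Real.pi * β) = Real.sqrt (2 * Real.pi) * (k / 2) := by
    rw [Real.sqrt_mul (by positivity), hβk, show k ^ 2 / 4 = (k / 2) ^ 2 by ring,
      Real.sqrt_sq (by positivity)]
  simp only [hG]
  rw [hshift, integral_eq_half_integral_add_shift hGc hGp]
  simp only [hsum]
  rw [intervalIntegral.integral_const_mul, integral_cos_sq_mul_stdPhi, hsqrt, ← hβk]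
  ring
end

section
/- Let ρ > 0, σ > 0, μ₀ ≥ 0, α_μ ∈ ℝ, and let PN(m) denote the projected normal density on [0, 2π) with parameters (μ₀, α_μ, σ). Then ∫_{0}^{2π} ∫_{0}^{2π} sin(y − α_μ) · vM(y | m, ρ) · PN(m) dm dy = 0; that is, the circular mean of the spatially varying von Mises (SvM) observation Y, whose mean angle m is drawn from the projected normal distribution with mean direction α_μ, equals α_μ. -/
open MeasureTheory

theorem Function.Periodic.intervalIntegral_comp_sub_left {f : ℝ → ℝ} {T : ℝ}
    (hf : Function.Periodic f T) (c : ℝ) :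
    ∫ x in (0:ℝ)..T, f (c - x) = ∫ x in (0:ℝ)..T, f x := by
  rw [intervalIntegral.integral_comp_sub_left]
  simpa using hf.intervalIntegral_add_eq (c - T) 0

theorem vM_periodic_left (m ρ : ℝ) : Function.Periodic (fun y => vM y m ρ) (2 * Real.pi) := by
  intro y
  simp only [vM, add_sub_right_comm, Real.cos_add_two_pi]

theorem vM_periodic_right (y ρ : ℝ) : Function.Periodic (fun m => vM y m ρ) (2 * Real.pi) := by
  intro m
  simp only [vM, ← sub_sub, Real.cos_sub_two_pi]

theorem vM_reflect (c y m ρ : ℝ) : vM (c - y) (c - m) ρ = vM y m ρ := by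
  rw [vM, vM, sub_sub_sub_cancel_left, ← Real.cos_neg, neg_sub]

theorem projNormal_periodic (μ₀ α σ : ℝ) :
    Function.Periodic (projNormal μ₀ α σ) (2 * Real.pi) := by
  intro m
  simp only [projNormal, add_sub_right_comm, Real.cos_add_two_pi, Real.sin_add_two_pi]

theorem projNormal_reflect (μ₀ α σ m : ℝ) :
    projNormal μ₀ α σ (2 * α - m) = projNormal μ₀ α σ m := by
  have h : 2 * α - m - α = -(m - α) := by ring
  simp only [projNormal, h, Real.sin_neg, Real.cos_neg, stdPhi, mul_neg, neg_div, neg_sq]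

theorem stmt_4 (ρ σ μ₀ αμ : ℝ) (hρ : 0 < ρ) (hσ : 0 < σ) (hμ₀ : 0 ≤ μ₀) :
    (∫ y in (0:ℝ)..(2 * Real.pi), ∫ m in (0:ℝ)..(2 * Real.pi),
        Real.sin (y - αμ) * vM y m ρ * projNormal μ₀ αμ σ m) = 0 := by
  set J : ℝ → ℝ := fun y => ∫ m in (0:ℝ)..(2 * Real.pi),
    Real.sin (y - αμ) * vM y m ρ * projNormal μ₀ αμ σ m with hJ
  have hper : Function.Periodic J (2 * Real.pi) := by
    intro y
    have hv (m : ℝ) : vM (y + 2 * Real.pi) m ρ = vM y m ρ := vM_periodic_left m ρ y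
    simp only [hJ, hv, add_sub_right_comm, Real.sin_add_two_pi]
  have hodd (y : ℝ) : J (2 * αμ - y) = -J y := by
    have hin : Function.Periodic (fun m => Real.sin (2 * αμ - y - αμ) *
        vM (2 * αμ - y) m ρ * projNormal μ₀ αμ σ m) (2 * Real.pi) := by
      intro m
      have hv : vM (2 * αμ - y) (m + 2 * Real.pi) ρ = vM (2 * αμ - y) m ρ :=
        vM_periodic_right (2 * αμ - y) ρ m
      simp only [hv, projNormal_periodic μ₀ αμ σ m]
    have h : 2 * αμ - y - αμ = -(y - αμ) := by ring
    simp only [hJ]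
    rw [← hin.intervalIntegral_comp_sub_left (2 * αμ)]
    simp only [vM_reflect, projNormal_reflect, h, Real.sin_neg, neg_mul,
      intervalIntegral.integral_neg]
  have key := hper.intervalIntegral_comp_sub_left (2 * αμ)
  simp only [hodd, intervalIntegral.integral_neg] at key
  linarith
end

section
/- Let K ≥ 1, let P be a probability mass function on {1, …, K}², let m_k ∈ ℝ, ρ_k > 0 for k = 1, …, K, and let α ∈ ℝ. Define the joint density h(y, y′) = Σ_{k,k′} P(k, k′) · vM(y | m_k, ρ_k) · vM(y′ | m_{k′}, ρ_{k′}) on [0, 2π)², and write E_h[v] = ∫∫ v(y, y′) h(y, y′) dy dy′, p_ℓ(k) = Σ_{k′} P(k, k′), p_{ℓ′}(k′) = Σ_{k} P(k, k′). Then (i) E_h[sin(y − α) sin(y′ − α)] = (1/2) Σ_{k,k′} P(k, k′) (I_1(ρ_k)/I_0(ρ_k)) (I_1(ρ_{k′})/I_0(ρ_{k′})) ( cos(m_k − m_{k′}) − cos(m_k + m_{k′} − 2α) ), and (ii) E_h[sin²(y − α)] = (1/2) ( 1 − Σ_k p_ℓ(k) (I_2(ρ_k)/I_0(ρ_k)) cos(2(m_k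 − α)) ), with the analogous formula for E_h[sin²(y′ − α)] using p_{ℓ′}; hence the Jammalamadaka–Sarma circular correlation of (y, y′) about α equals Σ_{k,k′} P(k,k′)(I_1(ρ_k)/I_0(ρ_k))(I_1(ρ_{k′})/I_0(ρ_{k′}))(cos(m_k − m_{k′}) − cos(m_k + m_{k′} − 2α)) divided by √( (1 − Σ_k p_ℓ(k)(I_2(ρ_k)/I_0(ρ_k))cos(2(m_k − α))) · (1 − Σ_{k′} p_{ℓ′}(k′)(I_2(ρ_{k′})/I_0(ρ_{k′}))cos(2(m_{k′} − α))) ), whenever both factors in the denominator are positive. -/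
open MeasureTheory

theorem integral_sin_mul_exp_cos (n : ℕ) (ρ : ℝ) :
    ∫ y in (0:ℝ)..(2 * Real.pi), Real.sin (n * y) * Real.exp (ρ * Real.cos y) = 0 := by
  have key := intervalIntegral.integral_comp_sub_left (a := 0) (b := 2 * Real.pi)
    (fun y => Real.sin (n * y) * Real.exp (ρ * Real.cos y)) (2 * Real.pi)
  have e : ∀ y : ℝ, Real.sin (n * (2 * Real.pi - y)) * Real.exp (ρ * Real.cos (2 * Real.pi - y))
      = -(Real.sin (n * y) * Real.exp (ρ * Real.cos y)) := fun y => by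
    rw [mul_sub, Real.sin_nat_mul_two_pi_sub, Real.cos_two_pi_sub, neg_mul]
  simp only [e, intervalIntegral.integral_neg, sub_self, sub_zero] at key
  linarith

theorem integral_cos_mul_exp_cos (n : ℕ) (ρ : ℝ) :
    ∫ y in (0:ℝ)..(2 * Real.pi), Real.cos (n * y) * Real.exp (ρ * Real.cos y)
      = 2 * Real.pi * besselI n ρ := by
  rw [besselI]
  field_simp

theorem besselI_zero_pos (ρ : ℝ) : 0 < besselI 0 ρ := by
  have hpi : (0:ℝ) < 2 * Real.pi := Real.two_pi_pos
  have hpos : 0 < ∫ y in (0:ℝ)..(2 * Real.pi),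
      Real.cos ((0:ℕ) * y) * Real.exp (ρ * Real.cos y) := by
    refine intervalIntegral.intervalIntegral_pos_of_pos
      (Continuous.intervalIntegrable (by fun_prop) _ _) (fun y => ?_) hpi
    simpa using Real.exp_pos (ρ * Real.cos y)
  rw [integral_cos_mul_exp_cos] at hpos
  exact (pos_iff_pos_of_mul_pos hpos).1 hpi

theorem integral_cos_mul_vM (n : ℕ) (a m ρ : ℝ) :
    ∫ y in (0:ℝ)..(2 * Real.pi), Real.cos (n * (y - a)) * vM y m ρ
      = besselI n ρ / besselI 0 ρ * Real.cos (n * (m - a)) := by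
  set F : ℝ → ℝ := fun y => Real.cos (n * (y + (m - a))) * vM (y + m) m ρ with hF
  have hper : Function.Periodic F (2 * Real.pi) := fun y => by
    have e₁ : (n:ℝ) * (y + 2 * Real.pi + (m - a)) = n * (y + (m - a)) + n * (2 * Real.pi) := by
      ring
    have e₂ : y + 2 * Real.pi + m - m = y + m - m + 2 * Real.pi := by ring
    simp only [hF, vM]
    rw [e₁, e₂, Real.cos_add_nat_mul_two_pi, Real.cos_add_two_pi]
  have hshift : ∀ y, Real.cos (n * (y - a)) * vM y m ρ = F (y - m) := fun y => by
    simp [hF]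
  have hF' : ∀ y, F y = (2 * Real.pi * besselI 0 ρ)⁻¹ *
      (Real.cos (n * (m - a)) * (Real.cos (n * y) * Real.exp (ρ * Real.cos y)) -
        Real.sin (n * (m - a)) * (Real.sin (n * y) * Real.exp (ρ * Real.cos y))) := fun y => by
    simp only [hF, vM, mul_add (n:ℝ) y, Real.cos_add, add_sub_cancel_right]
    ring
  calc _ = ∫ y in (0 - m)..(2 * Real.pi - m), F y := by
        simp_rw [hshift]
        exact intervalIntegral.integral_comp_sub_right F m
    _ = ∫ y in (0:ℝ)..(2 * Real.pi), F y := by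
        have := hper.intervalIntegral_add_eq (0 - m) 0
        rwa [show 0 - m + 2 * Real.pi = 2 * Real.pi - m by ring, zero_add] at this
    _ = _ := by
        simp_rw [hF']
        rw [intervalIntegral.integral_const_mul, intervalIntegral.integral_sub,
          intervalIntegral.integral_const_mul, intervalIntegral.integral_const_mul,
          integral_sin_mul_exp_cos, integral_cos_mul_exp_cos]
        · have := (besselI_zero_pos ρ).ne'
          field_simp
          ring
        all_goals exact Continuous.intervalIntegrable (by fun_prop) _ _

theorem continuous_vM (m ρ : ℝ) : Continuous fun y => vM y m ρ := by
  unfold vM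
  fun_prop

theorem integral_vM (m ρ : ℝ) : ∫ y in (0:ℝ)..(2 * Real.pi), vM y m ρ = 1 := by
  have := integral_cos_mul_vM 0 0 m ρ
  simpa [(besselI_zero_pos ρ).ne'] using this

theorem integral_sin_mul_vM (a m ρ : ℝ) :
    ∫ y in (0:ℝ)..(2 * Real.pi), Real.sin (y - a) * vM y m ρ
      = besselI 1 ρ / besselI 0 ρ * Real.sin (m - a) := by
  have := integral_cos_mul_vM 1 (a + Real.pi / 2) m ρ
  simpa [← sub_sub, Real.cos_sub_pi_div_two] using this

theorem integral_sin_sq_mul_vM (a m ρ : ℝ) :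
    ∫ y in (0:ℝ)..(2 * Real.pi), Real.sin (y - a) ^ 2 * vM y m ρ
      = (1 / 2) * (1 - besselI 2 ρ / besselI 0 ρ * Real.cos (2 * (m - a))) := by
  have hc := continuous_vM m ρ
  have e : ∀ y, Real.sin (y - a) ^ 2 * vM y m ρ
      = (1 / 2) * (vM y m ρ - Real.cos ((2:ℕ) * (y - a)) * vM y m ρ) := fun y => by
    rw [Real.sin_sq_eq_half_sub]
    push_cast
    ring
  simp_rw [e]
  rw [intervalIntegral.integral_const_mul, intervalIntegral.integral_sub, integral_vM,
    integral_cos_mul_vM]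
  · norm_num
  all_goals exact Continuous.intervalIntegrable (by fun_prop) _ _

/-- Expectations of products under a finite mixture of product densities. -/
theorem integral_integral_mul_mixture {ι : Type*} [Fintype ι] (a b : ℝ) (P : ι → ι → ℝ)
    (v : ι → ℝ → ℝ) (hv : ∀ k, Continuous (v k)) {f g : ℝ → ℝ}
    (hf : Continuous f) (hg : Continuous g) :
    ∫ y in a..b, ∫ y' in a..b, f y * g y' * ∑ k, ∑ k', P k k' * v k y * v k' y'
      = ∑ k, ∑ k', P k k' * (∫ y in a..b, f y * v k y) * ∫ y in a..b, g y * v k' y := by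
  have e : ∀ y y', f y * g y' * ∑ k, ∑ k', P k k' * v k y * v k' y'
      = ∑ k, ∑ k', (P k k' * (f y * v k y)) * (g y' * v k' y') := fun y y' => by
    simp_rw [Finset.mul_sum]
    exact Finset.sum_congr rfl fun k _ => Finset.sum_congr rfl fun k' _ => by ring
  have inner : ∀ y, ∫ y' in a..b, f y * g y' * ∑ k, ∑ k', P k k' * v k y * v k' y'
      = ∑ k, ∑ k', P k k' * (f y * v k y) * ∫ y in a..b, g y * v k' y := fun y => by
    simp_rw [e]
    rw [intervalIntegral.integral_finsetSum
      fun k _ => Continuous.intervalIntegrable (by fun_prop) _ _]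
    refine Finset.sum_congr rfl fun k _ => ?_
    rw [intervalIntegral.integral_finsetSum
      fun k' _ => Continuous.intervalIntegrable (by fun_prop) _ _]
    exact Finset.sum_congr rfl fun k' _ => intervalIntegral.integral_const_mul _ _
  simp_rw [inner]
  rw [intervalIntegral.integral_finsetSum
    fun k _ => Continuous.intervalIntegrable (by fun_prop) _ _]
  refine Finset.sum_congr rfl fun k _ => ?_
  rw [intervalIntegral.integral_finsetSum
    fun k' _ => Continuous.intervalIntegrable (by fun_prop) _ _]
  refine Finset.sum_congr rfl fun k' _ => ?_
  rw [intervalIntegral.integral_mul_const, intervalIntegral.integral_const_mul]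

theorem stmt_9 (K : ℕ) (hK : 1 ≤ K) (P : Fin K → Fin K → ℝ)
    (hP_nonneg : ∀ k k', 0 ≤ P k k') (hP_sum : ∑ k, ∑ k', P k k' = 1)
    (m ρ : Fin K → ℝ) (hρ : ∀ k, 0 < ρ k) (α : ℝ)
    (h : ℝ → ℝ → ℝ)
    (hdef : ∀ y y', h y y'
      = ∑ k, ∑ k', P k k' * vM y (m k) (ρ k) * vM y' (m k') (ρ k')) :
    (∫ y in (0:ℝ)..(2 * Real.pi), ∫ y' in (0:ℝ)..(2 * Real.pi),
        Real.sin (y - α) * Real.sin (y' - α) * h y y')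
      = (1 / 2) * ∑ k, ∑ k', P k k' *
          (besselI 1 (ρ k) / besselI 0 (ρ k)) * (besselI 1 (ρ k') / besselI 0 (ρ k')) *
          (Real.cos (m k - m k') - Real.cos (m k + m k' - 2 * α)) ∧
    (∫ y in (0:ℝ)..(2 * Real.pi), ∫ y' in (0:ℝ)..(2 * Real.pi),
        Real.sin (y - α) ^ 2 * h y y')
      = (1 / 2) * (1 - ∑ k, (∑ k', P k k') *
          (besselI 2 (ρ k) / besselI 0 (ρ k)) * Real.cos (2 * (m k - α))) ∧
    (∫ y in (0:ℝ)..(2 * Real.pi), ∫ y' in (0:ℝ)..(2 * Real.pi),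
        Real.sin (y' - α) ^ 2 * h y y')
      = (1 / 2) * (1 - ∑ k', (∑ k, P k k') *
          (besselI 2 (ρ k') / besselI 0 (ρ k')) * Real.cos (2 * (m k' - α))) ∧
    ((0 < 1 - ∑ k, (∑ k', P k k') *
          (besselI 2 (ρ k) / besselI 0 (ρ k)) * Real.cos (2 * (m k - α))) →
     (0 < 1 - ∑ k', (∑ k, P k k') *
          (besselI 2 (ρ k') / besselI 0 (ρ k')) * Real.cos (2 * (m k' - α))) →
     (∫ y in (0:ℝ)..(2 * Real.pi), ∫ y' in (0:ℝ)..(2 * Real.pi),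
          Real.sin (y - α) * Real.sin (y' - α) * h y y') /
        Real.sqrt
          ((∫ y in (0:ℝ)..(2 * Real.pi), ∫ y' in (0:ℝ)..(2 * Real.pi),
              Real.sin (y - α) ^ 2 * h y y') *
           (∫ y in (0:ℝ)..(2 * Real.pi), ∫ y' in (0:ℝ)..(2 * Real.pi),
              Real.sin (y' - α) ^ 2 * h y y'))
      = (∑ k, ∑ k', P k k' *
            (besselI 1 (ρ k) / besselI 0 (ρ k)) * (besselI 1 (ρ k') / besselI 0 (ρ k')) *
            (Real.cos (m k - m k') - Real.cos (m k + m k' - 2 * α))) /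
        Real.sqrt
          ((1 - ∑ k, (∑ k', P k k') *
              (besselI 2 (ρ k) / besselI 0 (ρ k)) * Real.cos (2 * (m k - α))) *
           (1 - ∑ k', (∑ k, P k k') *
              (besselI 2 (ρ k') / besselI 0 (ρ k')) * Real.cos (2 * (m k' - α))))) := by
  have hsin : Continuous fun y => Real.sin (y - α) := by fun_prop
  have hsin2 : Continuous fun y => Real.sin (y - α) ^ 2 := by fun_prop
  have mix {f g : ℝ → ℝ} (hf : Continuous f) (hg : Continuous g) :=
    integral_integral_mul_mixture 0 (2 * Real.pi) P (fun k y => vM y (m k) (ρ k))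
      (fun k => continuous_vM (m k) (ρ k)) hf hg
  have hcov := mix hsin hsin
  have hvar := mix hsin2 (continuous_const (y := (1:ℝ)))
  have hvar' := mix (continuous_const (y := (1:ℝ))) hsin2
  simp only [integral_sin_mul_vM, integral_sin_sq_mul_vM, integral_vM, one_mul, mul_one,
    ← hdef] at hcov hvar hvar'
  have hprod : ∀ x z : ℝ, Real.sin (x - α) * Real.sin (z - α)
      = (1 / 2) * (Real.cos (x - z) - Real.cos (x + z - 2 * α)) := fun x z => by
    rw [show x - z = (x - α) - (z - α) by ring, show x + z - 2 * α = (x - α) + (z - α) by ring,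
      Real.cos_sub, Real.cos_add]
    ring
  have half : ∀ (p c : Fin K → ℝ), ∑ k, p k = 1 →
      ∑ k, p k * ((1 / 2) * (1 - besselI 2 (ρ k) / besselI 0 (ρ k) * c k))
        = (1 / 2) * (1 - ∑ k, p k * (besselI 2 (ρ k) / besselI 0 (ρ k)) * c k) :=
    fun p c hp => by
      conv_rhs => enter [2, 1]; rw [← hp]
      rw [← Finset.sum_sub_distrib, Finset.mul_sum]
      exact Finset.sum_congr rfl fun k _ => by ring
  simp_rw [← Finset.sum_mul] at hvar
  rw [half _ _ hP_sum] at hvar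
  rw [Finset.sum_comm] at hvar'
  simp_rw [← Finset.sum_mul] at hvar'
  rw [half _ _ (Finset.sum_comm.trans hP_sum)] at hvar'
  have hcov' : ∑ k, ∑ k', P k k' * (besselI 1 (ρ k) / besselI 0 (ρ k) * Real.sin (m k - α)) *
        (besselI 1 (ρ k') / besselI 0 (ρ k') * Real.sin (m k' - α))
      = (1 / 2) * ∑ k, ∑ k', P k k' *
          (besselI 1 (ρ k) / besselI 0 (ρ k)) * (besselI 1 (ρ k') / besselI 0 (ρ k')) *
          (Real.cos (m k - m k') - Real.cos (m k + m k' - 2 * α)) := by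
    simp_rw [Finset.mul_sum]
    refine Finset.sum_congr rfl fun k _ => Finset.sum_congr rfl fun k' _ => ?_
    linear_combination (P k k' * (besselI 1 (ρ k) / besselI 0 (ρ k)) *
      (besselI 1 (ρ k') / besselI 0 (ρ k'))) * hprod (m k) (m k')
  rw [hcov'] at hcov
  refine ⟨hcov, hvar, hvar', fun _ _ => ?_⟩
  rw [hcov, hvar, hvar', mul_mul_mul_comm, Real.sqrt_mul (by norm_num),
    Real.sqrt_mul_self (by norm_num), mul_div_mul_left _ _ (by norm_num)]
end
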